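/- For every infinitely differentiable compactly supported function h : ℝ → ℝ, ∫_ℝ (2y·h′(y) + h(y))·(Kh)(y) dy = 4·∫_ℝ h″(y)² dy + 4·∫_ℝ h′(y)² dy + ∫_ℝ Y₁(y)·h′(y)² dy + ∫_ℝ Y₀(y)·h(y)² dy. -/

import Mathlib

open MeasureTheory

/-- Fourth-order operator `K f = f'''' - 2f'' + K₂·f'' + K₁·f' + K₀·f + f`. -/
noncomputable def Kop (K₂ K₁ K₀ f : ℝ → ℝ) (y : ℝ) : ℝ :=
  deriv (deriv (deriv (deriv f))) y - 2 * deriv (deriv f) y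
    + K₂ y * deriv (deriv f) y + K₁ y * deriv f y + K₀ y * f y + f y

/-- A continuous function vanishing off the support of a compactly supported one is integrable. -/
theorem integrable_of_continuous_of_forall_notMem_tsupport {h f : ℝ → ℝ}
    (hh : HasCompactSupport h) (hf : Continuous f) (hz : ∀ x, x ∉ tsupport h → f x = 0) :
    Integrable f :=
  hf.integrable_of_hasCompactSupport (HasCompactSupport.intro hh hz)

theorem stmt3 (K₂ K₁ K₀ : ℝ → ℝ)
    (hK₂ : ContDiff ℝ 2 K₂) (hK₁ : ContDiff ℝ 1 K₁) (hK₀ : ContDiff ℝ 1 K₀)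
    (Y₁ Y₀ : ℝ → ℝ)
    (hY₁ : ∀ y, Y₁ y = -2 * K₂ y - y * deriv K₂ y + 2 * y * K₁ y)
    (hY₀ : ∀ y, Y₀ y = (1 / 2) * (deriv (deriv K₂) y - deriv K₁ y - 2 * y * deriv K₀ y))
    (h : ℝ → ℝ) (hsmooth : ContDiff ℝ (⊤ : ℕ∞) h) (hsupp : HasCompactSupport h) :
    ∫ y : ℝ, (2 * y * deriv h y + h y) * Kop K₂ K₁ K₀ h y
      = 4 * (∫ y : ℝ, (deriv (deriv h) y) ^ 2) + 4 * (∫ y : ℝ, (deriv h y) ^ 2)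
        + (∫ y : ℝ, Y₁ y * (deriv h y) ^ 2) + ∫ y : ℝ, Y₀ y * (h y) ^ 2 := by
  have sm1 : ContDiff ℝ (⊤ : ℕ∞) (deriv h) := (contDiff_infty_iff_deriv.1 hsmooth).2
  have sm2 : ContDiff ℝ (⊤ : ℕ∞) (deriv (deriv h)) := (contDiff_infty_iff_deriv.1 sm1).2
  have sm3 : ContDiff ℝ (⊤ : ℕ∞) (deriv (deriv (deriv h))) := (contDiff_infty_iff_deriv.1 sm2).2
  have sm4 : ContDiff ℝ (⊤ : ℕ∞) (deriv (deriv (deriv (deriv h)))) :=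
    (contDiff_infty_iff_deriv.1 sm3).2
  have dh0 := fun y => ((contDiff_infty_iff_deriv.1 hsmooth).1 y).hasDerivAt
  have dh1 := fun y => ((contDiff_infty_iff_deriv.1 sm1).1 y).hasDerivAt
  have dh2 := fun y => ((contDiff_infty_iff_deriv.1 sm2).1 y).hasDerivAt
  have dh3 := fun y => ((contDiff_infty_iff_deriv.1 sm3).1 y).hasDerivAt
  have smK₂' : ContDiff ℝ 1 (deriv K₂) :=
    (contDiff_succ_iff_deriv (n := 1).1 (by simpa [one_add_one_eq_two] using hK₂)).2.2
  have dK₂ := fun y => (hK₂.differentiable (by norm_num) y).hasDerivAt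
  have dK₂' := fun y => (smK₂'.differentiable (by norm_num) y).hasDerivAt
  have dK₁ := fun y => (hK₁.differentiable (by norm_num) y).hasDerivAt
  have dK₀ := fun y => (hK₀.differentiable (by norm_num) y).hasDerivAt
  have c0 := hsmooth.continuous
  have c1 := sm1.continuous
  have c2 := sm2.continuous
  have c3 := sm3.continuous
  have c4 := sm4.continuous
  have cK₂ := hK₂.continuous
  have cK₂' := smK₂'.continuous
  have cK₂'' := smK₂'.continuous_deriv le_rfl
  have cK₁ := hK₁.continuous
  have cK₁' := hK₁.continuous_deriv le_rfl
  have cK₀ := hK₀.continuous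
  have cK₀' := hK₀.continuous_deriv le_rfl
  have z0 : ∀ x, x ∉ tsupport h → h x = 0 := fun x hx => image_eq_zero_of_notMem_tsupport hx
  have z {f : ℝ → ℝ} (hf : tsupport f ⊆ tsupport h) : tsupport (deriv f) ⊆ tsupport h :=
    (closure_minimal support_deriv_subset (isClosed_tsupport f)).trans hf
  have s1 := z subset_rfl
  have s2 := z s1
  have z1 : ∀ x, x ∉ tsupport h → deriv h x = 0 :=
    fun x hx => image_eq_zero_of_notMem_tsupport fun hx' => hx (s1 hx')
  have z2 : ∀ x, x ∉ tsupport h → deriv (deriv h) x = 0 :=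
    fun x hx => image_eq_zero_of_notMem_tsupport fun hx' => hx (s2 hx')
  obtain rfl : Y₁ = _ := funext hY₁
  obtain rfl : Y₀ = _ := funext hY₀
  have key := integral_eq_zero_of_hasDerivAt_of_integrable
    (f := fun y => 2 * y * deriv h y * deriv (deriv (deriv h)) y
      - 3 * (deriv h y * deriv (deriv h) y) - y * deriv (deriv h) y ^ 2
      + h y * deriv (deriv (deriv h)) y - 2 * y * deriv h y ^ 2 - 2 * (h y * deriv h y)
      + y * K₂ y * deriv h y ^ 2 + K₂ y * (h y * deriv h y)
      + (1 / 2) * ((K₁ y - deriv K₂ y) * h y ^ 2) + y * K₀ y * h y ^ 2 + y * h y ^ 2)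
    (f' := fun y => (2 * y * deriv h y + h y) * Kop K₂ K₁ K₀ h y
      - (4 * (deriv (deriv h) y) ^ 2 + 4 * (deriv h y) ^ 2
        + (-2 * K₂ y - y * deriv K₂ y + 2 * y * K₁ y) * (deriv h y) ^ 2
        + ((1 / 2) * (deriv (deriv K₂) y - deriv K₁ y - 2 * y * deriv K₀ y)) * (h y) ^ 2))
    (fun y => by
      have := ((((((((((((((hasDerivAt_id y).const_mul 2).mul (dh1 y)).mul (dh3 y)).sub
        (((dh1 y).mul (dh2 y)).const_mul 3)).sub ((hasDerivAt_id y).mul ((dh2 y).pow 2))).add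
        ((dh0 y).mul (dh3 y))).sub (((hasDerivAt_id y).const_mul 2).mul ((dh1 y).pow 2))).sub
        (((dh0 y).mul (dh1 y)).const_mul 2)).add
        (((hasDerivAt_id y).mul (dK₂ y)).mul ((dh1 y).pow 2))).add
        ((dK₂ y).mul ((dh0 y).mul (dh1 y)))).add
        ((((dK₁ y).sub (dK₂' y)).mul ((dh0 y).pow 2)).const_mul (1 / 2))).add
        (((hasDerivAt_id y).mul (dK₀ y)).mul ((dh0 y).pow 2))).add
        ((hasDerivAt_id y).mul ((dh0 y).pow 2)))
      refine this.congr_deriv ?_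
      simp [Kop]
      ring)
    (integrable_of_continuous_of_forall_notMem_tsupport hsupp
      (by unfold Kop; fun_prop) fun x hx => by simp [z0 x hx, z1 x hx, z2 x hx])
    (integrable_of_continuous_of_forall_notMem_tsupport hsupp
      (by fun_prop) fun x hx => by simp [z0 x hx, z1 x hx, z2 x hx])
  have iL : Integrable fun y => (2 * y * deriv h y + h y) * Kop K₂ K₁ K₀ h y :=
    integrable_of_continuous_of_forall_notMem_tsupport hsupp
      (by unfold Kop; fun_prop) fun x hx => by simp [z0 x hx, z1 x hx]
  have i2 : Integrable fun y => 4 * (deriv (deriv h) y) ^ 2 :=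
    integrable_of_continuous_of_forall_notMem_tsupport hsupp
      (by fun_prop) fun x hx => by simp [z2 x hx]
  have i1 : Integrable fun y => 4 * (deriv h y) ^ 2 :=
    integrable_of_continuous_of_forall_notMem_tsupport hsupp
      (by fun_prop) fun x hx => by simp [z1 x hx]
  have iY₁ : Integrable fun y =>
      (-2 * K₂ y - y * deriv K₂ y + 2 * y * K₁ y) * (deriv h y) ^ 2 :=
    integrable_of_continuous_of_forall_notMem_tsupport hsupp
      (by fun_prop) fun x hx => by simp [z1 x hx]
  have iY₀ : Integrable fun y =>
      ((1 / 2) * (deriv (deriv K₂) y - deriv K₁ y - 2 * y * deriv K₀ y)) * (h y) ^ 2 :=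
    integrable_of_continuous_of_forall_notMem_tsupport hsupp
      (by fun_prop) fun x hx => by simp [z0 x hx]
  rw [integral_sub iL (((i2.fun_add i1).fun_add iY₁).fun_add iY₀), integral_add ((i2.fun_add i1).fun_add iY₁) iY₀,
    integral_add (i2.fun_add i1) iY₁, integral_add i2 i1, integral_const_mul, integral_const_mul,
    sub_eq_zero] at key
  exact key
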